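/- Let q ≥ 1 and n > 2q, and let Ω ⊆ ℝⁿ be an open set containing the closed unit ball. Let ρ : [0,∞) → [0,∞) be continuously differentiable with ρ′(s) ≤ 0 for all s ≥ 0. Let ω be a measurable family of alternating q-forms on Ω such that x ↦ e(Q(x)) is integrable on the unit ball. Assume the following first-variation (r-stationarity) identity: for every smooth nonnegative nonincreasing function η : [0,∞) → ℝ with compact support contained in [0,1), one has ∫_{B₁} e(Q(x)) (n·η(|x|) + |x|·η′(|x|)) dx = 2q ∫_{B₁} Q(x) ρ(Q(x)) η(|x|) dx + 2q ∫_{B₁} ρ(Q(x)) |x| η′(|x|) ‖∂_r⌟ω(x)‖² dx. Then for all 0 < r₁ < r₂ ≤ 1, r₁^{2q−n} ∫_{B_{r₁}} e(Q(x)) dx ≤ r₂^{2q−n} ∫_{B_{r₂}} e(Q(x)) dx. -/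

import Mathlib

open MeasureTheory Metric

/-- The squared norm of an alternating `q`-linear form on `ℝⁿ` induced by the standard
inner product: `Q = Σ_{i₁<⋯<i_q} ω(e_{i₁},…,e_{i_q})²`. -/
noncomputable def altNormSq {n q : ℕ}
    (α : AlternatingMap ℝ (EuclideanSpace ℝ (Fin n)) ℝ (Fin q)) : ℝ :=
  ∑ f ∈ Finset.univ.filter (fun f : Fin q → Fin n => ∀ i j : Fin q, i < j → f i < f j),
    (α fun i => EuclideanSpace.single (f i) (1:ℝ)) ^ 2

/-- The squared norm of the contraction `u⌟α` of an alternating `q`-linear form `α`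
with a vector `u`, i.e. of the `(q−1)`-form `(v₂,…,v_q) ↦ α(u, v₂, …, v_q)`. -/
noncomputable def contrNormSq {n q : ℕ} (u : EuclideanSpace ℝ (Fin n))
    (α : AlternatingMap ℝ (EuclideanSpace ℝ (Fin n)) ℝ (Fin q)) : ℝ :=
  ∑ g ∈ Finset.univ.filter
      (fun g : Fin (q - 1) → Fin n => ∀ i j : Fin (q - 1), i < j → g i < g j),
    (α fun i : Fin q => if h : (i : ℕ) = 0 then u
        else EuclideanSpace.single (g ⟨(i : ℕ) - 1, by have := i.isLt; omega⟩) (1:ℝ)) ^ 2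

/-- The nonlinear Hodge energy density `e(s) = ∫₀ˢ ρ(t) dt`. -/
noncomputable def hodgeE (ρ : ℝ → ℝ) (s : ℝ) : ℝ := ∫ t in (0:ℝ)..s, ρ t

section

open Set Filter Topology

theorem altNormSq_nonneg {n q : ℕ}
    (α : AlternatingMap ℝ (EuclideanSpace ℝ (Fin n)) ℝ (Fin q)) : 0 ≤ altNormSq α :=
  Finset.sum_nonneg fun _ _ => sq_nonneg _

theorem contrNormSq_nonneg {n q : ℕ} (u : EuclideanSpace ℝ (Fin n))
    (α : AlternatingMap ℝ (EuclideanSpace ℝ (Fin n)) ℝ (Fin q)) : 0 ≤ contrNormSq u α :=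
  Finset.sum_nonneg fun _ _ => sq_nonneg _

theorem hodgeE_nonneg {ρ : ℝ → ℝ} (hρ0 : ∀ s : ℝ, 0 ≤ s → 0 ≤ ρ s) {s : ℝ} (hs : 0 ≤ s) :
    0 ≤ hodgeE ρ s :=
  intervalIntegral.integral_nonneg hs fun t ht => hρ0 t ht.1

theorem mul_le_hodgeE {ρ : ℝ → ℝ} (hρC1 : ContDiff ℝ 1 ρ)
    (hρ' : ∀ s : ℝ, 0 ≤ s → deriv ρ s ≤ 0) {s : ℝ} (hs : 0 ≤ s) :
    s * ρ s ≤ hodgeE ρ s := by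
  have hanti : AntitoneOn ρ (Set.Ici 0) := by
    refine antitoneOn_of_deriv_nonpos (convex_Ici 0) hρC1.continuous.continuousOn
      (hρC1.differentiable one_ne_zero).differentiableOn fun x hx => hρ' x ?_
    rw [interior_Ici] at hx
    exact le_of_lt hx
  have h := intervalIntegral.integral_mono_on (μ := volume) (f := fun _ => ρ s) (g := ρ) hs
    (by simp) (hρC1.continuous.intervalIntegrable _ _)
    (fun t ht => hanti ht.1 hs ht.2)
  simpa [hodgeE] using h

/-- A smooth cutoff with support in `[a + 1/j, b - 1/j]`, tending to the indicator function
of the open interval `(a, b)` as `j → ∞`. -/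
noncomputable def ioCutoff (a b : ℝ) (j : ℕ) (s : ℝ) : ℝ :=
  Real.smoothTransition (j * (s - a) - 1) * Real.smoothTransition (j * (b - s) - 1)

section Cutoff

variable {a b : ℝ} {j : ℕ} {s : ℝ}

theorem ioCutoff_nonneg : 0 ≤ ioCutoff a b j s :=
  mul_nonneg (Real.smoothTransition.nonneg _) (Real.smoothTransition.nonneg _)

theorem ioCutoff_le_one : ioCutoff a b j s ≤ 1 :=
  mul_le_one₀ (Real.smoothTransition.le_one _) (Real.smoothTransition.nonneg _)
    (Real.smoothTransition.le_one _)

theorem ioCutoff_of_le_left (h : s ≤ a) : ioCutoff a b j s = 0 := by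
  have : (j : ℝ) * (s - a) ≤ 0 := mul_nonpos_of_nonneg_of_nonpos j.cast_nonneg (by linarith)
  rw [ioCutoff, Real.smoothTransition.zero_of_nonpos (by linarith), zero_mul]

theorem ioCutoff_of_right_le (h : j * (b - s) ≤ 1) : ioCutoff a b j s = 0 := by
  rw [ioCutoff, Real.smoothTransition.zero_of_nonpos (x := j * (b - s) - 1) (by linarith),
    mul_zero]

theorem contDiff_ioCutoff : ContDiff ℝ (⊤ : ℕ∞) (ioCutoff a b j) := by
  unfold ioCutoff
  exact (Real.smoothTransition.contDiff.comp (by fun_prop)).mul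
    (Real.smoothTransition.contDiff.comp (by fun_prop))

theorem tendsto_smoothTransition_natCast_mul {c : ℝ} (hc : 0 < c) :
    Tendsto (fun j : ℕ => Real.smoothTransition (j * c - 1)) atTop (𝓝 1) := by
  refine tendsto_const_nhds.congr' ?_
  filter_upwards [(tendsto_natCast_atTop_atTop.atTop_mul_const hc).eventually_ge_atTop 2]
    with j hj
  exact (Real.smoothTransition.one_of_one_le (by linarith)).symm

theorem tendsto_ioCutoff (ha : a < s) (hb : s < b) :
    Tendsto (fun j => ioCutoff a b j s) atTop (𝓝 1) := by
  simpa [ioCutoff] using (tendsto_smoothTransition_natCast_mul (sub_pos.2 ha)).mul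
    (tendsto_smoothTransition_natCast_mul (sub_pos.2 hb))

end Cutoff

/-- The weight `s ↦ s ^ (p - 1)`, smoothly cut off to `(a, b)`. -/
noncomputable def cutoffPow (p : ℤ) (a b : ℝ) (j : ℕ) (s : ℝ) : ℝ :=
  s ^ (p - 1) * ioCutoff a b j s

/-- The primitive of `-cutoffPow` vanishing at `b`. -/
noncomputable def cutoffPowPrimitive (p : ℤ) (a b : ℝ) (j : ℕ) (r : ℝ) : ℝ :=
  ∫ s in r..b, cutoffPow p a b j s

section CutoffPow

variable {p : ℤ} {a b : ℝ} {j : ℕ} {r s : ℝ}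

theorem cutoffPow_of_le_left (h : s ≤ a) : cutoffPow p a b j s = 0 := by
  rw [cutoffPow, ioCutoff_of_le_left h, mul_zero]

theorem cutoffPow_of_right_le (h : j * (b - s) ≤ 1) : cutoffPow p a b j s = 0 := by
  rw [cutoffPow, ioCutoff_of_right_le h, mul_zero]

theorem cutoffPow_of_ge (h : b ≤ s) : cutoffPow p a b j s = 0 :=
  cutoffPow_of_right_le <|
    (mul_nonpos_of_nonneg_of_nonpos j.cast_nonneg (by linarith)).trans zero_le_one

theorem cutoffPow_nonneg (ha : 0 < a) : 0 ≤ cutoffPow p a b j s := by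
  rcases le_or_gt s a with h | h
  · rw [cutoffPow_of_le_left h]
  · exact mul_nonneg (zpow_nonneg (ha.trans h).le _) ioCutoff_nonneg

theorem cutoffPow_le (ha : 0 < a) (hp : p < 0) : cutoffPow p a b j s ≤ a ^ (p - 1) := by
  rcases le_or_gt s a with h | h
  · rw [cutoffPow_of_le_left h]; positivity
  · refine (mul_le_of_le_one_right (zpow_nonneg (ha.trans h).le _) ioCutoff_le_one).trans ?_
    obtain ⟨m, hm⟩ : ∃ m : ℕ, p - 1 = -(m : ℤ) := ⟨(1 - p).toNat, by omega⟩
    rw [hm, zpow_neg, zpow_neg, zpow_natCast, zpow_natCast]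
    gcongr

theorem contDiff_cutoffPow (ha : 0 < a) : ContDiff ℝ (⊤ : ℕ∞) (cutoffPow p a b j) := by
  rw [contDiff_iff_contDiffAt]
  intro s
  rcases lt_or_ge s a with h | h
  · refine (contDiffAt_const (c := (0 : ℝ))).congr_of_eventuallyEq ?_
    filter_upwards [Iio_mem_nhds h] with t ht
    exact cutoffPow_of_le_left (le_of_lt ht)
  · have hs : s ≠ 0 := (ha.trans_le h).ne'
    refine ContDiffAt.mul ?_ contDiff_ioCutoff.contDiffAt
    obtain ⟨m, hm | hm⟩ := (p - 1).eq_nat_or_neg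
    · simp only [hm, zpow_natCast]
      fun_prop
    · simp only [hm, zpow_neg, zpow_natCast]
      exact (contDiffAt_id.pow m).inv (pow_ne_zero m hs)

theorem continuous_cutoffPow (ha : 0 < a) : Continuous (cutoffPow p a b j) :=
  (contDiff_cutoffPow ha).continuous

theorem hasDerivAt_cutoffPowPrimitive (ha : 0 < a) :
    HasDerivAt (cutoffPowPrimitive p a b j) (-cutoffPow p a b j r) r :=
  intervalIntegral.integral_hasDerivAt_left ((continuous_cutoffPow ha).intervalIntegrable _ _)
    ((continuous_cutoffPow ha).stronglyMeasurableAtFilter _ _)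
    (continuous_cutoffPow ha).continuousAt

theorem deriv_cutoffPowPrimitive (ha : 0 < a) :
    deriv (cutoffPowPrimitive p a b j) = fun r => -cutoffPow p a b j r :=
  funext fun _ => (hasDerivAt_cutoffPowPrimitive ha).deriv

theorem contDiff_cutoffPowPrimitive (ha : 0 < a) :
    ContDiff ℝ (⊤ : ℕ∞) (cutoffPowPrimitive p a b j) := by
  rw [contDiff_infty_iff_deriv, deriv_cutoffPowPrimitive ha]
  exact ⟨fun _ => (hasDerivAt_cutoffPowPrimitive ha).differentiableAt,
    (contDiff_cutoffPow ha).neg⟩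

theorem antitone_cutoffPowPrimitive (ha : 0 < a) : Antitone (cutoffPowPrimitive p a b j) := by
  refine antitone_of_deriv_nonpos
    (fun _ => (hasDerivAt_cutoffPowPrimitive ha).differentiableAt) fun r => ?_
  rw [deriv_cutoffPowPrimitive ha]
  exact neg_nonpos.2 (cutoffPow_nonneg ha)

theorem cutoffPowPrimitive_of_right_le (h : j * (b - r) ≤ 1) :
    cutoffPowPrimitive p a b j r = 0 := by
  refine intervalIntegral.integral_zero_ae (ae_of_all _ fun s hs => cutoffPow_of_right_le ?_)
  rcases le_total r b with hrb | hrb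
  · rw [uIoc_of_le hrb] at hs
    exact (mul_le_mul_of_nonneg_left (by linarith [hs.1]) j.cast_nonneg).trans h
  · rw [uIoc_of_ge hrb] at hs
    exact (mul_nonpos_of_nonneg_of_nonpos j.cast_nonneg (by linarith [hs.1])).trans zero_le_one

theorem cutoffPowPrimitive_of_ge (h : b ≤ r) : cutoffPowPrimitive p a b j r = 0 :=
  cutoffPowPrimitive_of_right_le <|
    (mul_nonpos_of_nonneg_of_nonpos j.cast_nonneg (by linarith)).trans zero_le_one

theorem cutoffPowPrimitive_nonneg (ha : 0 < a) : 0 ≤ cutoffPowPrimitive p a b j r := by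
  rw [← cutoffPowPrimitive_of_ge (p := p) (a := a) (j := j) (le_max_right r b)]
  exact antitone_cutoffPowPrimitive ha (le_max_left r b)

theorem cutoffPowPrimitive_le (ha : 0 < a) (hp : p < 0) (hb : b ≤ 1) (hr : 0 ≤ r) :
    cutoffPowPrimitive p a b j r ≤ a ^ (p - 1) := by
  have hpos : 0 < a ^ (p - 1) := by positivity
  rcases le_total b r with h | h
  · rw [cutoffPowPrimitive_of_ge h]; exact hpos.le
  · have := intervalIntegral.integral_mono_on (μ := volume) (g := fun _ => a ^ (p - 1)) h
      ((continuous_cutoffPow (p := p) (b := b) (j := j) ha).intervalIntegrable _ _)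
      (by simp) (fun s _ => cutoffPow_le ha hp)
    rw [intervalIntegral.integral_const, smul_eq_mul] at this
    refine this.trans (mul_le_of_le_one_left hpos.le (by linarith))

theorem cutoffPowPrimitive_of_le_left (ha : 0 < a) (h : r ≤ a) :
    cutoffPowPrimitive p a b j r = cutoffPowPrimitive p a b j a := by
  have hi : ∀ x y : ℝ, IntervalIntegrable (cutoffPow p a b j) volume x y :=
    fun _ _ => (continuous_cutoffPow ha).intervalIntegrable _ _
  rw [cutoffPowPrimitive, ← intervalIntegral.integral_add_adjacent_intervals (hi r a) (hi a b),
    intervalIntegral.integral_zero_ae, zero_add, cutoffPowPrimitive]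
  refine ae_of_all _ fun s hs => cutoffPow_of_le_left ?_
  rw [uIoc_of_le h] at hs
  exact hs.2

theorem tendsto_cutoffPowPrimitive (ha : 0 < a) (hp : p < 0) (har : a ≤ r) (hrb : r ≤ b) :
    Tendsto (fun j => cutoffPowPrimitive p a b j r) atTop (𝓝 ((b ^ p - r ^ p) / p)) := by
  have hlim : (b ^ p - r ^ p) / p = ∫ s in r..b, s ^ (p - 1) := by
    rw [integral_zpow]
    · simp
    · refine Or.inr ⟨by omega, fun h0 => ?_⟩
      rw [uIcc_of_le hrb] at h0
      linarith [h0.1]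
  rw [hlim]
  refine intervalIntegral.tendsto_integral_filter_of_dominated_convergence
    (fun _ => a ^ (p - 1)) (Eventually.of_forall fun j =>
      (continuous_cutoffPow ha).aestronglyMeasurable)
    (Eventually.of_forall fun j => ae_of_all _ fun s _ => ?_) (by simp) ?_
  · rw [Real.norm_of_nonneg (cutoffPow_nonneg ha)]
    exact cutoffPow_le ha hp
  · filter_upwards [compl_mem_ae_iff.2 (measure_singleton (μ := volume) b)] with s hsb hs
    rw [uIoc_of_le hrb] at hs
    simpa [cutoffPow] using (tendsto_ioCutoff (har.trans_lt hs.1)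
      (lt_of_le_of_ne hs.2 hsb)).const_mul (s ^ (p - 1))

theorem tendsto_radial_cutoff (ha : 0 < a) (hab : a < b) (hp : p < 0) :
    Tendsto (fun j => -p * cutoffPowPrimitive p a b j r - r * cutoffPow p a b j r) atTop
      (𝓝 ((Iic a).indicator (fun _ => a ^ p) r - (Iio b).indicator (fun _ => b ^ p) r)) := by
  have hp0 : (p : ℝ) ≠ 0 := by exact_mod_cast hp.ne
  rcases le_or_gt r a with hra | hra
  · have h := (tendsto_cutoffPowPrimitive ha hp le_rfl hab.le).const_mul (-(p : ℝ))
    simp only [cutoffPowPrimitive_of_le_left ha hra, cutoffPow_of_le_left hra, mul_zero, sub_zero]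
    convert h using 2
    rw [indicator_of_mem (by exact hra), indicator_of_mem (by exact hra.trans_lt hab)]
    field_simp
    ring
  · rw [indicator_of_notMem (by simpa using hra)]
    rcases lt_or_ge r b with hrb | hrb
    · have h := ((tendsto_cutoffPowPrimitive ha hp hra.le hrb.le).const_mul (-(p : ℝ))).sub
        (((tendsto_ioCutoff hra hrb).const_mul (r ^ (p - 1))).const_mul r)
      have hval : -(p : ℝ) * ((b ^ p - r ^ p) / p) - r * (r ^ (p - 1) * 1) = 0 - b ^ p := by
        rw [mul_one, ← zpow_one_add₀ (ha.trans hra).ne', add_sub_cancel]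
        field_simp
        ring
      rw [hval] at h
      rw [indicator_of_mem (by exact hrb)]
      exact h
    · simp [cutoffPowPrimitive_of_ge hrb, cutoffPow_of_ge hrb, hrb]

end CutoffPow

end

open Set Filter Topology in
/-- conformal monotonicity for the nonlinear Hodge energy of an
r-stationary family of alternating `q`-forms, `q ≥ 1`, `n > 2q`, with conformally
weightless density `ρ` satisfying `ρ′ ≤ 0`. -/
theorem stmt_0 (n q : ℕ) (hq : 1 ≤ q) (hn : 2 * q < n)
    (Ω : Set (EuclideanSpace ℝ (Fin n))) (hΩopen : IsOpen Ω)
    (hΩball : closedBall (0 : EuclideanSpace ℝ (Fin n)) 1 ⊆ Ω)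
    (ρ : ℝ → ℝ) (hρC1 : ContDiff ℝ 1 ρ)
    (hρ0 : ∀ s : ℝ, 0 ≤ s → 0 ≤ ρ s)
    (hρ' : ∀ s : ℝ, 0 ≤ s → deriv ρ s ≤ 0)
    (ω : EuclideanSpace ℝ (Fin n) → AlternatingMap ℝ (EuclideanSpace ℝ (Fin n)) ℝ (Fin q))
    (hωmeas : ∀ v : Fin q → EuclideanSpace ℝ (Fin n), Measurable fun x => ω x v)
    (hint : IntegrableOn (fun x => hodgeE ρ (altNormSq (ω x)))
      (ball (0 : EuclideanSpace ℝ (Fin n)) 1) volume)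
    (hstat : ∀ η : ℝ → ℝ, ContDiff ℝ (⊤ : ℕ∞) η → (∀ r : ℝ, 0 ≤ r → 0 ≤ η r) →
      AntitoneOn η (Set.Ici (0:ℝ)) → (∃ a : ℝ, a < 1 ∧ ∀ r : ℝ, a ≤ r → η r = 0) →
      (∫ x in ball (0 : EuclideanSpace ℝ (Fin n)) 1,
          hodgeE ρ (altNormSq (ω x)) * (n * η ‖x‖ + ‖x‖ * deriv η ‖x‖))
        = 2 * q * (∫ x in ball (0 : EuclideanSpace ℝ (Fin n)) 1,
              altNormSq (ω x) * ρ (altNormSq (ω x)) * η ‖x‖)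
          + 2 * q * ∫ x in ball (0 : EuclideanSpace ℝ (Fin n)) 1,
              ρ (altNormSq (ω x)) * ‖x‖ * deriv η ‖x‖ * contrNormSq (‖x‖⁻¹ • x) (ω x)) :
    ∀ r₁ r₂ : ℝ, 0 < r₁ → r₁ < r₂ → r₂ ≤ 1 →
      r₁ ^ ((2 * q : ℤ) - n) *
          (∫ x in ball (0 : EuclideanSpace ℝ (Fin n)) r₁, hodgeE ρ (altNormSq (ω x)))
        ≤ r₂ ^ ((2 * q : ℤ) - n) *
            ∫ x in ball (0 : EuclideanSpace ℝ (Fin n)) r₂, hodgeE ρ (altNormSq (ω x)) := by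
  intro r₁ r₂ h₁ h₁₂ h₂
  set E : EuclideanSpace ℝ (Fin n) → ℝ := fun x => hodgeE ρ (altNormSq (ω x)) with hE
  set p : ℤ := (2 * q : ℤ) - n with hp_def
  have hp : p < 0 := by omega
  have hpR : (p : ℝ) = 2 * q - n := by simp [hp_def]
  have hE0 : ∀ x, 0 ≤ E x := fun x => hodgeE_nonneg hρ0 (altNormSq_nonneg _)
  set B : Set (EuclideanSpace ℝ (Fin n)) := ball 0 1
  have hC : 0 < r₁ ^ (p - 1) := by positivity
  have hint_η : ∀ j, IntegrableOn (fun x => E x * cutoffPowPrimitive p r₁ r₂ j ‖x‖) B := by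
    intro j
    refine hint.mul_bdd (c := r₁ ^ (p - 1))
      ((contDiff_cutoffPowPrimitive h₁).continuous.comp continuous_norm).aestronglyMeasurable
      (ae_of_all _ fun x => ?_)
    rw [Real.norm_of_nonneg (cutoffPowPrimitive_nonneg h₁)]
    exact cutoffPowPrimitive_le h₁ hp h₂ (norm_nonneg x)
  have hint_ψ : ∀ j, IntegrableOn (fun x => E x * (‖x‖ * cutoffPow p r₁ r₂ j ‖x‖)) B := by
    intro j
    refine hint.mul_bdd (c := r₁ ^ (p - 1)) (continuous_norm.mul
      ((continuous_cutoffPow h₁).comp continuous_norm)).aestronglyMeasurable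
      ((ae_restrict_iff' measurableSet_ball).2 (ae_of_all _ fun x hx => ?_))
    rw [Real.norm_of_nonneg (mul_nonneg (norm_nonneg x) (cutoffPow_nonneg h₁))]
    exact (mul_le_of_le_one_left (cutoffPow_nonneg h₁) (mem_ball_zero_iff.1 hx).le).trans
      (cutoffPow_le h₁ hp)
  have hineq : ∀ j : ℕ, ∫ x in B, E x * (-p * cutoffPowPrimitive p r₁ r₂ (j + 1) ‖x‖
      - ‖x‖ * cutoffPow p r₁ r₂ (j + 1) ‖x‖) ≤ 0 := by
    intro j
    have hst := hstat (cutoffPowPrimitive p r₁ r₂ (j + 1)) (contDiff_cutoffPowPrimitive h₁)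
      (fun _ _ => cutoffPowPrimitive_nonneg h₁) ((antitone_cutoffPowPrimitive h₁).antitoneOn _)
      ⟨r₂ - 1 / ((j + 1 : ℕ) : ℝ), by have : 0 < 1 / ((j + 1 : ℕ) : ℝ) := by positivity
                                      linarith, fun r hr => by
        refine cutoffPowPrimitive_of_right_le ?_
        rw [← le_div_iff₀' (by positivity)]
        linarith⟩
    rw [deriv_cutoffPowPrimitive h₁] at hst
    have hlast : ∫ x in B, ρ (altNormSq (ω x)) * ‖x‖ * -cutoffPow p r₁ r₂ (j + 1) ‖x‖
        * contrNormSq (‖x‖⁻¹ • x) (ω x) ≤ 0 :=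
      integral_nonpos fun x => mul_nonpos_of_nonpos_of_nonneg
        (mul_nonpos_of_nonneg_of_nonpos
          (mul_nonneg (hρ0 _ (altNormSq_nonneg _)) (norm_nonneg x))
          (neg_nonpos.2 (cutoffPow_nonneg h₁))) (contrNormSq_nonneg _ _)
    have hmid : ∫ x in B, altNormSq (ω x) * ρ (altNormSq (ω x))
        * cutoffPowPrimitive p r₁ r₂ (j + 1) ‖x‖
        ≤ ∫ x in B, E x * cutoffPowPrimitive p r₁ r₂ (j + 1) ‖x‖ :=
      integral_mono_of_nonneg
        (ae_of_all _ fun x => mul_nonneg (mul_nonneg (altNormSq_nonneg _)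
          (hρ0 _ (altNormSq_nonneg _))) (cutoffPowPrimitive_nonneg h₁))
        (hint_η _)
        (ae_of_all _ fun x => mul_le_mul_of_nonneg_right
          (mul_le_hodgeE hρC1 hρ' (altNormSq_nonneg _)) (cutoffPowPrimitive_nonneg h₁))
    have hsplit : ∀ c : ℝ, ∫ x in B, E x * (c * cutoffPowPrimitive p r₁ r₂ (j + 1) ‖x‖
        - ‖x‖ * cutoffPow p r₁ r₂ (j + 1) ‖x‖)
        = c * (∫ x in B, E x * cutoffPowPrimitive p r₁ r₂ (j + 1) ‖x‖)
          - ∫ x in B, E x * (‖x‖ * cutoffPow p r₁ r₂ (j + 1) ‖x‖) := by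
      intro c
      rw [← integral_const_mul, ← integral_sub ((hint_η _).const_mul c) (hint_ψ _)]
      congr 1 with x
      ring
    simp only [mul_neg, ← sub_eq_add_neg] at hst hlast
    rw [hsplit] at hst
    rw [hsplit, hpR]
    have hq0 : (0 : ℝ) ≤ 2 * q := by positivity
    linarith [mul_le_mul_of_nonneg_left hmid hq0, mul_nonpos_of_nonneg_of_nonpos hq0 hlast]
  have hlim : Tendsto (fun j : ℕ => ∫ x in B, E x *
      (-p * cutoffPowPrimitive p r₁ r₂ (j + 1) ‖x‖ - ‖x‖ * cutoffPow p r₁ r₂ (j + 1) ‖x‖)) atTop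
      (𝓝 (∫ x in B, E x * ((Iic r₁).indicator (fun _ => r₁ ^ p) ‖x‖
        - (Iio r₂).indicator (fun _ => r₂ ^ p) ‖x‖))) := by
    have hcont : ∀ j, Continuous fun x : EuclideanSpace ℝ (Fin n) =>
        -p * cutoffPowPrimitive p r₁ r₂ (j + 1) ‖x‖ - ‖x‖ * cutoffPow p r₁ r₂ (j + 1) ‖x‖ :=
      fun j => (continuous_const.mul ((contDiff_cutoffPowPrimitive h₁).continuous.comp
        continuous_norm)).sub (continuous_norm.mul
          ((continuous_cutoffPow h₁).comp continuous_norm))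
    refine tendsto_integral_of_dominated_convergence
      (fun x => E x * ((-p + 1) * r₁ ^ (p - 1)))
      (fun j => hint.aestronglyMeasurable.mul (hcont j).aestronglyMeasurable)
      (hint.mul_const _) (fun j => (ae_restrict_iff' measurableSet_ball).2
        (ae_of_all _ fun x hx => ?_)) (ae_of_all _ fun x => ?_)
    · have hx1 : ‖x‖ ≤ 1 := (mem_ball_zero_iff.1 hx).le
      have hp' : (0 : ℝ) < -p := by exact_mod_cast neg_pos.2 hp
      have hη0 := cutoffPowPrimitive_nonneg (p := p) (b := r₂) (j := j + 1) (r := ‖x‖) h₁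
      have hη := cutoffPowPrimitive_le (j := j + 1) h₁ hp h₂ (norm_nonneg x)
      have hψ0 := cutoffPow_nonneg (p := p) (b := r₂) (j := j + 1) (s := ‖x‖) h₁
      have hψ := (mul_le_of_le_one_left hψ0 hx1).trans (cutoffPow_le h₁ hp)
      rw [norm_mul, Real.norm_of_nonneg (hE0 x)]
      refine mul_le_mul_of_nonneg_left ?_ (hE0 x)
      rw [Real.norm_eq_abs, abs_le]
      constructor <;> nlinarith [mul_le_mul_of_nonneg_left hη hp'.le, mul_nonneg hp'.le hη0,
        mul_nonneg (norm_nonneg x) hψ0, mul_pos hp' hC]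
    · exact ((tendsto_radial_cutoff h₁ h₁₂ hp).comp
        (tendsto_add_atTop_nat 1)).const_mul (E x)
  have hle := le_of_tendsto' hlim hineq
  have hball : ball (0 : EuclideanSpace ℝ (Fin n)) r₂ ⊆ B := ball_subset_ball h₂
  have hcball : closedBall (0 : EuclideanSpace ℝ (Fin n)) r₁ ⊆ B :=
    closedBall_subset_ball (h₁₂.trans_le h₂)
  have hrw : (fun x => E x * ((Iic r₁).indicator (fun _ => r₁ ^ p) ‖x‖
        - (Iio r₂).indicator (fun _ => r₂ ^ p) ‖x‖))
      = fun x => (closedBall (0 : EuclideanSpace ℝ (Fin n)) r₁).indicator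
            (fun x => r₁ ^ p * E x) x
          - (ball (0 : EuclideanSpace ℝ (Fin n)) r₂).indicator (fun x => r₂ ^ p * E x) x := by
    funext x
    by_cases hx₁ : ‖x‖ ≤ r₁ <;> by_cases hx₂ : ‖x‖ < r₂ <;>
      simp [hx₁, hx₂, indicator, mul_sub, mul_comm]
  rw [hrw, integral_sub ((hint.const_mul _).indicator measurableSet_closedBall)
      ((hint.const_mul _).indicator measurableSet_ball),
    setIntegral_indicator measurableSet_closedBall, setIntegral_indicator measurableSet_ball,
    inter_eq_self_of_subset_right hcball, inter_eq_self_of_subset_right hball,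
    integral_const_mul, integral_const_mul] at hle
  have hmono : ∫ x in ball (0 : EuclideanSpace ℝ (Fin n)) r₁, E x
      ≤ ∫ x in closedBall (0 : EuclideanSpace ℝ (Fin n)) r₁, E x :=
    setIntegral_mono_set (hint.mono_set hcball) (ae_of_all _ hE0)
      ball_subset_closedBall.eventuallyLE
  linarith [mul_le_mul_of_nonneg_left hmono (zpow_pos h₁ p).le]
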